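/- arXiv:2605.01830 — 2 statements merged into one kernel-verified Lean document; each statement's English description precedes it below -/
import Mathlib

section
/- There exists a unique b(1) ∈ (0,π) such that b(1)²/4 = Im(Li₂(1 + i)); this value is b(1) = √(4G + π·log 2), and consequently Catalan's constant satisfies G = b(1)²/4 − (π/4)·log 2. -/
open scoped Real

/-- The principal-branch dilogarithm, `Li₂(z) = −∫₀¹ Log(1 − z t)/t dt`. -/
noncomputable def Li2 (z : ℂ) : ℂ :=
  -∫ t in (0:ℝ)..1, Complex.log (1 - z * (t : ℂ)) / (t : ℂ)

/-- Catalan's constant `G = ∫₀¹ arctan(x)/x dx`. -/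
noncomputable def G : ℝ := ∫ x in (0:ℝ)..1, Real.arctan x / x

theorem Real.arctan_le_self_of_nonneg {x : ℝ} (hx : 0 ≤ x) : Real.arctan x ≤ x := by
  simpa [Real.tan_arctan] using
    Real.le_tan (Real.arctan_nonneg.2 hx) (Real.arctan_lt_pi_div_two x)

theorem Real.arctan_one_sub_div_one_add {x : ℝ} (h0 : 0 ≤ x) :
    Real.arctan ((1 - x) / (1 + x)) = π / 4 - Real.arctan x := by
  have hx : 0 < 1 + x := by linarith
  have hlt : x * ((1 - x) / (1 + x)) < 1 := by
    rw [← mul_div_assoc, div_lt_one hx]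
    nlinarith [sq_nonneg x]
  have hne : 1 - x * ((1 - x) / (1 + x)) ≠ 0 := by linarith
  have h := Real.arctan_add hlt
  have h2 : (x + (1 - x) / (1 + x)) / (1 - x * ((1 - x) / (1 + x))) = 1 := by
    rw [div_eq_one_iff_eq hne]
    field_simp
    ring
  rw [h2, Real.arctan_one] at h
  linarith

theorem integral_inv_one_add_zero_one : ∫ x in (0:ℝ)..1, (1 + x)⁻¹ = Real.log 2 := by
  rw [intervalIntegral.integral_comp_add_left (fun x : ℝ => x⁻¹) 1,
    integral_inv_of_pos (by norm_num) (by norm_num)]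
  norm_num

theorem continuousOn_inv_one_add : ContinuousOn (fun x : ℝ => (1 + x)⁻¹) (Set.Icc 0 1) :=
  ContinuousOn.inv₀ (by fun_prop) fun x hx => by linarith [hx.1]

theorem integral_arctan_div_one_add :
    ∫ x in (0:ℝ)..1, Real.arctan x * (1 + x)⁻¹ = π / 8 * Real.log 2 := by
  have hc := continuousOn_inv_one_add
  rw [← Set.uIcc_of_le (zero_le_one' ℝ)] at hc
  have hcA : ContinuousOn (fun x : ℝ => Real.arctan x * (1 + x)⁻¹) (Set.uIcc 0 1) :=
    Real.continuous_arctan.continuousOn.mul hc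
  have hne : ∀ x ∈ Set.uIcc (0:ℝ) 1, 1 + x ≠ 0 := fun x hx => by
    rw [Set.uIcc_of_le zero_le_one] at hx
    linarith [hx.1]
  have himg : (fun x : ℝ => (1 - x) / (1 + x)) '' Set.uIcc 0 1 ⊆ Set.uIcc 0 1 := by
    rintro _ ⟨x, hx, rfl⟩
    rw [Set.uIcc_of_le zero_le_one] at hx ⊢
    have : 0 < 1 + x := by linarith [hx.1]
    exact ⟨div_nonneg (by linarith [hx.2]) this.le, (div_le_one this).2 (by linarith [hx.1])⟩
  have key := intervalIntegral.integral_comp_mul_deriv'' (a := 0) (b := 1)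
    (f := fun x : ℝ => (1 - x) / (1 + x)) (f' := fun x => -2 / (1 + x) ^ 2)
    (g := fun x => Real.arctan x * (1 + x)⁻¹)
    (ContinuousOn.div (by fun_prop) (by fun_prop) hne)
    (fun x hx => by
      have hx' : 1 + x ≠ 0 := hne x (Set.Ioo_subset_Icc_self hx)
      have := ((hasDerivAt_id x).const_sub 1).div ((hasDerivAt_id x).const_add 1) hx'
      refine (this.congr_deriv ?_).hasDerivWithinAt
      simp only [id]
      ring)
    (ContinuousOn.div (by fun_prop) (by fun_prop) fun x hx => pow_ne_zero 2 (hne x hx))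
    (hcA.mono himg)
  have hcongr : ∫ x in (0:ℝ)..1, ((fun x => Real.arctan x * (1 + x)⁻¹) ∘
        fun x : ℝ => (1 - x) / (1 + x)) x * (-2 / (1 + x) ^ 2) =
      ∫ x in (0:ℝ)..1, (Real.arctan x * (1 + x)⁻¹ - π / 4 * (1 + x)⁻¹) := by
    refine intervalIntegral.integral_congr fun x hx => ?_
    have hx' := hne x hx
    rw [Set.uIcc_of_le zero_le_one] at hx
    have h2 : 1 + (1 - x) / (1 + x) = 2 / (1 + x) := by
      field_simp
      ring
    simp only [Function.comp]
    rw [Real.arctan_one_sub_div_one_add hx.1, h2]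
    field_simp
    ring
  rw [hcongr, intervalIntegral.integral_sub hcA.intervalIntegrable
    (hc.intervalIntegrable.const_mul _), intervalIntegral.integral_const_mul,
    integral_inv_one_add_zero_one] at key
  norm_num at key
  rw [intervalIntegral.integral_symm 0 1] at key
  linarith

theorem integral_comp_div_one_sub {g : ℝ → ℝ} (hg : ContinuousOn g (Set.Icc 0 1)) :
    ∫ t in (0:ℝ)..(1 / 2), g (t / (1 - t)) * (1 / (1 - t) ^ 2) = ∫ u in (0:ℝ)..1, g u := by
  have hle : (0:ℝ) ≤ 1 / 2 := by norm_num
  have hne : ∀ x ∈ Set.uIcc (0:ℝ) (1 / 2), 1 - x ≠ 0 := fun x hx => by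
    rw [Set.uIcc_of_le hle] at hx
    linarith [hx.2]
  have key := intervalIntegral.integral_comp_mul_deriv'' (a := 0) (b := 1 / 2)
    (f := fun x : ℝ => x / (1 - x)) (f' := fun x => 1 / (1 - x) ^ 2) (g := g)
    (ContinuousOn.div (by fun_prop) (by fun_prop) hne)
    (fun x hx => by
      have hx' : 1 - x ≠ 0 := hne x (Set.Ioo_subset_Icc_self hx)
      have := (hasDerivAt_id x).div ((hasDerivAt_id x).const_sub 1) hx'
      refine (this.congr_deriv ?_).hasDerivWithinAt
      simp only [id]
      ring)
    (ContinuousOn.div (by fun_prop) (by fun_prop) fun x hx => pow_ne_zero 2 (hne x hx))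
    (hg.mono (by
      rintro _ ⟨x, hx, rfl⟩
      rw [Set.uIcc_of_le hle] at hx
      have : 0 < 1 - x := by linarith [hx.2]
      exact ⟨div_nonneg hx.1 this.le, (div_le_one this).2 (by linarith [hx.2])⟩))
  norm_num at key ⊢
  exact key

theorem continuous_dslope_of_differentiableAt {E : Type*} [NormedAddCommGroup E]
    [NormedSpace ℝ E] {f : ℝ → E} {a : ℝ} (hf : Continuous f) (hd : DifferentiableAt ℝ f a) :
    Continuous (dslope f a) := by
  rw [← continuousOn_univ, continuousOn_dslope Filter.univ_mem]
  exact ⟨hf.continuousOn, hd⟩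

theorem continuous_dslope_arctan : Continuous (dslope Real.arctan 0) :=
  continuous_dslope_of_differentiableAt Real.continuous_arctan (Real.differentiableAt_arctan 0)

theorem mul_dslope_arctan (x : ℝ) : x * dslope Real.arctan 0 x = Real.arctan x := by
  simpa using sub_smul_dslope Real.arctan 0 x

theorem G_eq_integral_dslope : G = ∫ x in (0:ℝ)..1, dslope Real.arctan 0 x := by
  refine intervalIntegral.integral_congr_Ioo_of_le zero_le_one fun x hx => ?_
  rw [div_eq_iff hx.1.ne', mul_comm, mul_dslope_arctan]

theorem G_nonneg : 0 ≤ G :=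
  intervalIntegral.integral_nonneg zero_le_one fun _ hx =>
    div_nonneg (Real.arctan_nonneg.2 hx.1) hx.1

theorem G_le_one : G ≤ 1 := by
  have h : ∫ x in (0:ℝ)..1, dslope Real.arctan 0 x ≤ ∫ _ in (0:ℝ)..1, (1:ℝ) := by
    refine intervalIntegral.integral_mono_on_of_le_Ioo zero_le_one
      (continuous_dslope_arctan.intervalIntegrable _ _) (by simp) fun x hx => ?_
    have := mul_dslope_arctan x
    have := Real.arctan_le_self_of_nonneg hx.1.le
    by_contra! hlt
    nlinarith [hx.1]
  rw [G_eq_integral_dslope]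
  simpa using h

theorem one_sub_one_add_I_mul_re (t : ℝ) : (1 - (1 + Complex.I) * (t : ℂ)).re = 1 - t := by
  simp

theorem one_sub_one_add_I_mul_im (t : ℝ) : (1 - (1 + Complex.I) * (t : ℂ)).im = -t := by
  simp

theorem one_sub_one_add_I_mul_mem_slitPlane (t : ℝ) :
    1 - (1 + Complex.I) * (t : ℂ) ∈ Complex.slitPlane := by
  rw [Complex.mem_slitPlane_iff, one_sub_one_add_I_mul_re, one_sub_one_add_I_mul_im]
  by_cases h : t = 0
  · left; simp [h]
  · right; simpa using h

theorem arg_one_sub_one_add_I_mul {t : ℝ} (ht : t < 1) :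
    (1 - (1 + Complex.I) * (t : ℂ)).arg = -Real.arctan (t / (1 - t)) := by
  have h := abs_lt.1 (Complex.abs_arg_lt_pi_div_two_iff.2
    (Or.inl (by rw [one_sub_one_add_I_mul_re]; linarith) :
      0 < (1 - (1 + Complex.I) * (t : ℂ)).re ∨ 1 - (1 + Complex.I) * (t : ℂ) = 0))
  rw [← Real.arctan_tan h.1 h.2, Complex.tan_arg, one_sub_one_add_I_mul_re,
    one_sub_one_add_I_mul_im, neg_div, Real.arctan_neg]

theorem intervalIntegrable_log_one_sub_div :
    IntervalIntegrable (fun t : ℝ => Complex.log (1 - (1 + Complex.I) * (t : ℂ)) / (t : ℂ))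
      MeasureTheory.volume 0 1 := by
  have hd : Differentiable ℝ fun t : ℝ => Complex.log (1 - (1 + Complex.I) * (t : ℂ)) := by
    intro t
    have hi : HasDerivAt (fun t : ℝ => 1 - (1 + Complex.I) * (t : ℂ)) _ t :=
      (((hasDerivAt_id t).ofReal_comp).const_mul (1 + Complex.I)).const_sub 1
    exact (hi.clog_real (one_sub_one_add_I_mul_mem_slitPlane t)).differentiableAt
  refine ((continuous_dslope_of_differentiableAt hd.continuous
    (hd 0)).intervalIntegrable 0 1).congr_uIoo fun t ht => ?_
  rw [Set.uIoo_of_le zero_le_one] at ht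
  have h0 : (t : ℂ) ≠ 0 := by exact_mod_cast ht.1.ne'
  rw [dslope_of_ne _ ht.1.ne', slope]
  simp [div_eq_inv_mul]

theorem log_one_sub_div_im {t : ℝ} (ht : t < 1) :
    (Complex.log (1 - (1 + Complex.I) * (t : ℂ)) / (t : ℂ)).im =
      -(Real.arctan (t / (1 - t)) / t) := by
  rw [Complex.div_ofReal_im, Complex.log_im, arg_one_sub_one_add_I_mul ht, neg_div]

theorem Li2_one_add_I_im : (Li2 (1 + Complex.I)).im =
    ∫ t in (0:ℝ)..1, Real.arctan (t / (1 - t)) / t := by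
  have h := Complex.imCLM.intervalIntegral_comp_comm intervalIntegrable_log_one_sub_div
  simp only [Complex.imCLM_apply] at h
  rw [Li2, Complex.neg_im, ← h, ← intervalIntegral.integral_neg]
  refine intervalIntegral.integral_congr_Ioo_of_le zero_le_one fun t ht => ?_
  simp only [log_one_sub_div_im ht.2, neg_neg]

theorem intervalIntegrable_arctan_div_one_sub_div :
    IntervalIntegrable (fun t : ℝ => Real.arctan (t / (1 - t)) / t)
      MeasureTheory.volume 0 1 := by
  have h : IntervalIntegrable (fun t : ℝ =>
      (Complex.log (1 - (1 + Complex.I) * (t : ℂ)) / (t : ℂ)).im) MeasureTheory.volume 0 1 :=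
    ⟨intervalIntegrable_log_one_sub_div.1.im, intervalIntegrable_log_one_sub_div.2.im⟩
  refine h.neg.congr_uIoo fun t ht => ?_
  rw [Set.uIoo_of_le zero_le_one] at ht
  simp only [Pi.neg_apply, log_one_sub_div_im ht.2, neg_neg]

theorem integral_arctan_div_one_sub_div_left :
    ∫ t in (0:ℝ)..(1 / 2), Real.arctan (t / (1 - t)) / t = G - π / 8 * Real.log 2 := by
  have hA : IntervalIntegrable (fun x : ℝ => Real.arctan x * (1 + x)⁻¹)
      MeasureTheory.volume 0 1 := by
    refine ContinuousOn.intervalIntegrable ?_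
    rw [Set.uIcc_of_le zero_le_one]
    exact Real.continuous_arctan.continuousOn.mul continuousOn_inv_one_add
  rw [G_eq_integral_dslope, ← integral_arctan_div_one_add, ← intervalIntegral.integral_sub
    (continuous_dslope_arctan.intervalIntegrable _ _) hA, ← integral_comp_div_one_sub
    (g := fun x => dslope Real.arctan 0 x - Real.arctan x * (1 + x)⁻¹)
    (continuous_dslope_arctan.continuousOn.sub
      (Real.continuous_arctan.continuousOn.mul continuousOn_inv_one_add))]
  refine intervalIntegral.integral_congr_Ioo_of_le (by norm_num) fun t ht => ?_
  have ht0 : t ≠ 0 := ht.1.ne'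
  have ht1 : 1 - t ≠ 0 := by linarith [ht.2]
  have h2 : 1 + t / (1 - t) = 1 / (1 - t) := by
    field_simp
    ring
  simp only [h2]
  rw [← mul_dslope_arctan (t / (1 - t))]
  field_simp

theorem integral_arctan_div_one_sub_div_right :
    ∫ t in (1 / 2 : ℝ)..1, Real.arctan (t / (1 - t)) / t = 3 * π / 8 * Real.log 2 := by
  have hc := continuousOn_inv_one_add
  have hcA : ContinuousOn (fun x : ℝ => Real.arctan x * (1 + x)⁻¹) (Set.Icc 0 1) :=
    Real.continuous_arctan.continuousOn.mul hc
  have h1 := integral_comp_div_one_sub ((hc.const_smul (π / 2)).sub hcA)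
  have hi := hc
  have hiA := hcA
  rw [← Set.uIcc_of_le (zero_le_one' ℝ)] at hi hiA
  simp only [smul_eq_mul, Pi.sub_apply, Pi.smul_apply] at h1
  rw [intervalIntegral.integral_sub (hi.intervalIntegrable.const_mul _) hiA.intervalIntegrable,
    intervalIntegral.integral_const_mul, integral_inv_one_add_zero_one,
    integral_arctan_div_one_add] at h1
  have h2 := intervalIntegral.integral_comp_sub_left (a := 0) (b := 1 / 2)
    (fun t : ℝ => Real.arctan (t / (1 - t)) / t) 1
  norm_num only at h2
  rw [← h2, show 3 * π / 8 * Real.log 2 = π / 2 * Real.log 2 - π / 8 * Real.log 2 by ring, ← h1]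
  refine intervalIntegral.integral_congr_Ioo_of_le (by norm_num) fun t ht => ?_
  have ht0 : 0 < t := ht.1
  have ht1 : 0 < 1 - t := by linarith [ht.2]
  have h3 : 1 + t / (1 - t) = 1 / (1 - t) := by
    field_simp
    ring
  have h4 : (1 - t) / (1 - (1 - t)) = (t / (1 - t))⁻¹ := by
    rw [inv_div, sub_sub_cancel]
  simp only [h3, h4]
  rw [Real.arctan_inv_of_pos (div_pos ht0 ht1)]
  field_simp

theorem Li2_one_add_I_im_eq : (Li2 (1 + Complex.I)).im = G + π / 4 * Real.log 2 := by
  have hi := intervalIntegrable_arctan_div_one_sub_div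
  have hsub : ∀ a b : ℝ, a ∈ Set.Icc 0 1 → b ∈ Set.Icc 0 1 →
      Set.uIcc a b ⊆ Set.uIcc (0:ℝ) 1 := fun a b ha hb => by
    rw [Set.uIcc_of_le (zero_le_one' ℝ)]
    exact Set.uIcc_subset_Icc ha hb
  rw [Li2_one_add_I_im, ← intervalIntegral.integral_add_adjacent_intervals
    (hi.mono_set (hsub 0 (1 / 2) (by norm_num) (by norm_num)))
    (hi.mono_set (hsub (1 / 2) 1 (by norm_num) (by norm_num))),
    integral_arctan_div_one_sub_div_left, integral_arctan_div_one_sub_div_right]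
  ring

theorem stmt_9 :
    (∃! b, b ∈ Set.Ioo (0:ℝ) π ∧ b ^ 2 / 4 = (Li2 (1 + Complex.I)).im) ∧
    Real.sqrt (4 * G + π * Real.log 2) ∈ Set.Ioo (0:ℝ) π ∧
    Real.sqrt (4 * G + π * Real.log 2) ^ 2 / 4 = (Li2 (1 + Complex.I)).im ∧
    G = Real.sqrt (4 * G + π * Real.log 2) ^ 2 / 4 - π / 4 * Real.log 2 := by
  have hlog : 0 < Real.log 2 := Real.log_pos one_lt_two
  have hpos : 0 < 4 * G + π * Real.log 2 := by
    have := G_nonneg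
    positivity
  have hlt : 4 * G + π * Real.log 2 < π ^ 2 := by
    nlinarith [G_le_one, Real.pi_gt_three, Real.log_two_lt_d9]
  have hsq := Real.sq_sqrt hpos.le
  have hmem : Real.sqrt (4 * G + π * Real.log 2) ∈ Set.Ioo (0:ℝ) π :=
    ⟨Real.sqrt_pos.2 hpos, (Real.sqrt_lt' Real.pi_pos).2 hlt⟩
  have heq : Real.sqrt (4 * G + π * Real.log 2) ^ 2 / 4 = (Li2 (1 + Complex.I)).im := by
    rw [hsq, Li2_one_add_I_im_eq]
    ring
  refine ⟨⟨_, ⟨hmem, heq⟩, fun b hb => ?_⟩, hmem, heq, ?_⟩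
  · refine ((Real.sqrt_eq_iff_mul_self_eq_of_pos hb.1.1).2 ?_).symm
    have := hb.2
    rw [Li2_one_add_I_im_eq] at this
    linarith
  · rw [hsq]
    ring
end

section
/- Let n ≥ 2 be an integer. Then Catalan's constant satisfies G = ∫₀^{π/n} arctan(cot(π/n)·tanh(x))/x dx + Σ_{k=1}^∞ [ Ti₂(1/(nk − 1)) − Ti₂(1/(nk + 1)) ], where the series converges. -/
open scoped Real

/-- The inverse tangent integral `Ti₂(y) = ∫₀^y arctan(x)/x dx`. -/
noncomputable def Ti2 (y : ℝ) : ℝ :=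
  ∫ x in (0:ℝ)..y, Real.arctan x / x

open Filter Topology MeasureTheory Finset

theorem Complex.arg_eq_arctan_of_re_pos {z : ℂ} (hz : 0 < z.re) :
    z.arg = Real.arctan (z.im / z.re) := by
  have h := abs_lt.1 (Complex.abs_arg_lt_pi_div_two_iff.2 (Or.inl hz))
  rw [← Complex.tan_arg, Real.arctan_tan h.1 h.2]

/-- The argument of the `N`-th partial Euler product of `sin (a + x * I)`. -/
noncomputable def eulerArg (a x : ℝ) (N : ℕ) : ℝ :=
  Real.arctan (x / a) - ∑ k ∈ range N,
    (Real.arctan (x / (π * (k + 1) - a)) - Real.arctan (x / (π * (k + 1) + a)))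

theorem pi_mul_succ_sub_pos {a : ℝ} (ha : a ≤ π / 2) (k : ℕ) : 0 < π * ((k : ℝ) + 1) - a := by
  have := Real.pi_pos
  have : 0 ≤ π * (k : ℝ) := by positivity
  linarith

theorem arctan_div_le_arctan_div {x c d : ℝ} (hx : 0 ≤ x) (hc : 0 < c) (hcd : c ≤ d) :
    Real.arctan (x / d) ≤ Real.arctan (x / c) :=
  Real.arctan_mono (by gcongr)

theorem arctan_sub_arctan_nonneg {a x : ℝ} (ha : 0 < a) (ha' : a ≤ π / 2) (hx : 0 ≤ x) (k : ℕ) :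
    0 ≤ Real.arctan (x / (π * (k + 1) - a)) - Real.arctan (x / (π * (k + 1) + a)) :=
  sub_nonneg.2 (arctan_div_le_arctan_div hx (pi_mul_succ_sub_pos ha' k) (by linarith))

theorem eulerArg_le {a x : ℝ} (ha : 0 < a) (ha' : a ≤ π / 2) (hx : 0 ≤ x) (N : ℕ) :
    eulerArg a x N ≤ Real.arctan (x / a) :=
  sub_le_self _ (sum_nonneg fun k _ => arctan_sub_arctan_nonneg ha ha' hx k)

theorem eulerArg_nonneg {a x : ℝ} (ha : 0 < a) (ha' : a ≤ π / 2) (hx : 0 ≤ x) (N : ℕ) :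
    0 ≤ eulerArg a x N := by
  have key : Real.arctan (x / (π * N + a)) ≤ eulerArg a x N := by
    induction N with
    | zero => simp [eulerArg]
    | succ N ih =>
      have h : Real.arctan (x / (π * (N + 1) - a)) ≤ Real.arctan (x / (π * N + a)) :=
        arctan_div_le_arctan_div hx (by positivity) (by linarith)
      simp only [eulerArg, sum_range_succ] at ih ⊢
      push_cast
      linarith
  exact le_trans (Real.arctan_nonneg.2 (by positivity)) key

theorem arg_one_sub_sq_div {a x : ℝ} (ha : 0 < a) (ha' : a ≤ π / 2) (k : ℕ) :
    (1 - (((a : ℂ) + x * Complex.I) / π) ^ 2 / ((k : ℂ) + 1) ^ 2) ≠ 0 ∧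
    (1 - (((a : ℂ) + x * Complex.I) / π) ^ 2 / ((k : ℂ) + 1) ^ 2).arg =
      -(Real.arctan (x / (π * (k + 1) - a)) - Real.arctan (x / (π * (k + 1) + a))) := by
  have hc : 0 < π * ((k : ℝ) + 1) := by have := Real.pi_pos; positivity
  have hm := pi_mul_succ_sub_pos ha' k
  have hp : 0 < π * ((k : ℝ) + 1) + a := by positivity
  set c : ℝ := π * ((k : ℝ) + 1) with hcdef
  let u : ℂ := ⟨c + a, x⟩
  let v : ℂ := ⟨c - a, -x⟩
  have hu : u.arg = Real.arctan (x / (c + a)) := Complex.arg_eq_arctan_of_re_pos (z := u) hp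
  have hv : v.arg = -Real.arctan (x / (c - a)) := by
    rw [Complex.arg_eq_arctan_of_re_pos (z := v) hm, ← Real.arctan_neg, ← neg_div]
  have hu0 : u ≠ 0 := fun h => hp.ne' (congrArg Complex.re h)
  have hv0 : v ≠ 0 := fun h => hm.ne' (congrArg Complex.re h)
  have huv : u * v = (c : ℂ) ^ 2 - ((a : ℂ) + x * Complex.I) ^ 2 := by
    have h1 : u = c + (a + x * Complex.I) := by apply Complex.ext <;> simp [u]
    have h2 : v = c - (a + x * Complex.I) := by apply Complex.ext <;> simp [v]
    rw [h1, h2]; ring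
  have hk : ((k : ℂ) + 1) ≠ 0 := by exact_mod_cast k.succ_ne_zero
  have hpi : (π : ℂ) ≠ 0 := by exact_mod_cast Real.pi_ne_zero
  have e : 1 - (((a : ℂ) + x * Complex.I) / π) ^ 2 / ((k : ℂ) + 1) ^ 2
      = (((c ^ 2)⁻¹ : ℝ) : ℂ) * (u * v) := by
    rw [huv, hcdef]
    push_cast
    field_simp
  have b1 := Real.neg_pi_div_two_lt_arctan (x / (c + a))
  have b2 := Real.arctan_lt_pi_div_two (x / (c + a))
  have b3 := Real.neg_pi_div_two_lt_arctan (x / (c - a))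
  have b4 := Real.arctan_lt_pi_div_two (x / (c - a))
  rw [e]
  refine ⟨mul_ne_zero (by exact_mod_cast (by positivity)) (mul_ne_zero hu0 hv0), ?_⟩
  rw [Complex.arg_real_mul _ (by positivity), Complex.arg_mul hu0 hv0, hu, hv]
  · ring
  · rw [hu, hv]; constructor <;> linarith

theorem arg_euler_prod {a x : ℝ} (ha : 0 < a) (ha' : a ≤ π / 2) (hx : 0 ≤ x) (N : ℕ) :
    (π * (((a : ℂ) + x * Complex.I) / π) *
      ∏ k ∈ range N, (1 - (((a : ℂ) + x * Complex.I) / π) ^ 2 / ((k : ℂ) + 1) ^ 2)).arg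
      = eulerArg a x N := by
  have hpi : (π : ℂ) ≠ 0 := by exact_mod_cast Real.pi_ne_zero
  rw [mul_div_cancel₀ _ hpi]
  have hre : 0 < ((a : ℂ) + x * Complex.I).re := by simpa using ha
  have h0 : ((a : ℂ) + x * Complex.I) ≠ 0 := fun h => by simp [h] at hre
  induction N with
  | zero => simp [eulerArg, Complex.arg_eq_arctan_of_re_pos hre]
  | succ N ih =>
    obtain ⟨hN, hN'⟩ := arg_one_sub_sq_div (x := x) ha ha' N
    have hs : eulerArg a x (N + 1) = eulerArg a x N +
        -(Real.arctan (x / (π * (N + 1) - a)) - Real.arctan (x / (π * (N + 1) + a))) := by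
      simp only [eulerArg, sum_range_succ]; ring
    rw [prod_range_succ, ← mul_assoc, Complex.arg_mul _ hN, ih, hN', hs]
    · rw [ih, hN', ← hs]
      have h1 := eulerArg_nonneg ha ha' hx (N + 1)
      have h2 := eulerArg_le ha ha' hx (N + 1)
      have h3 := Real.arctan_lt_pi_div_two (x / a)
      have := Real.pi_pos
      constructor <;> linarith
    · exact mul_ne_zero h0 (prod_ne_zero_iff.2 fun k _ => (arg_one_sub_sq_div ha ha' k).1)

theorem tendsto_eulerArg {a x : ℝ} (ha : 0 < a) (ha' : a ≤ π / 2) (hx : 0 ≤ x) :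
    Tendsto (eulerArg a x) atTop (𝓝 (Real.arctan (Real.cot a * Real.tanh x))) := by
  have hpi : (π : ℂ) ≠ 0 := by exact_mod_cast Real.pi_ne_zero
  have hsin : 0 < Real.sin a := Real.sin_pos_of_pos_of_lt_pi ha (by linarith [Real.pi_pos])
  have e : Complex.sin ((a : ℂ) + x * Complex.I) =
      ⟨Real.sin a * Real.cosh x, Real.cos a * Real.sinh x⟩ := by
    rw [Complex.sin_add_mul_I, Complex.mk_eq_add_mul_I]
    push_cast
    rfl
  have hre : 0 < (Complex.sin ((a : ℂ) + x * Complex.I)).re := by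
    rw [e]; exact mul_pos hsin (Real.cosh_pos x)
  have h := Complex.tendsto_euler_sin_prod (((a : ℂ) + x * Complex.I) / π)
  rw [mul_div_cancel₀ _ hpi] at h
  have h' := (Complex.continuousAt_arg (Or.inl hre)).tendsto.comp h
  rw [Complex.arg_eq_arctan_of_re_pos hre, e] at h'
  have hval : Real.cos a * Real.sinh x / (Real.sin a * Real.cosh x)
      = Real.cot a * Real.tanh x := by
    rw [Real.cot_eq_cos_div_sin, Real.tanh_eq_sinh_div_cosh, div_mul_div_comm]
  simp only [hval] at h'
  refine h'.congr fun N => ?_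
  rw [← arg_euler_prod ha ha' hx N, Function.comp_apply, mul_div_cancel₀ _ hpi]

theorem arctan_div_div_le {x d : ℝ} (hx : 0 ≤ x) (hd : 0 < d) :
    Real.arctan (x / d) / x ≤ 1 / d := by
  rcases hx.eq_or_lt with rfl | hx'
  · simp [hd.le]
  · rw [div_le_iff₀ hx', one_div_mul_eq_div]
    have h := Real.le_tan (Real.arctan_nonneg.2 (div_nonneg hx hd.le))
      (Real.arctan_lt_pi_div_two (x / d))
    rwa [Real.tan_arctan] at h

theorem intervalIntegrable_arctan_div_div {a d : ℝ} (ha : 0 ≤ a) (hd : 0 < d) :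
    IntervalIntegrable (fun x => Real.arctan (x / d) / x) volume 0 a := by
  refine (intervalIntegrable_const (c := 1 / d)).mono_fun
    (Measurable.aestronglyMeasurable (by fun_prop)) ?_
  refine (ae_restrict_iff' measurableSet_uIoc).2 (ae_of_all _ fun x hx => ?_)
  rw [Set.uIoc_of_le ha] at hx
  have h0 : 0 ≤ Real.arctan (x / d) / x :=
    div_nonneg (Real.arctan_nonneg.2 (div_nonneg hx.1.le hd.le)) hx.1.le
  beta_reduce
  rw [Real.norm_of_nonneg h0, Real.norm_of_nonneg (by positivity)]
  exact arctan_div_div_le hx.1.le hd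

theorem integral_arctan_div_div {a d : ℝ} (hd : 0 < d) :
    ∫ x in (0:ℝ)..a, Real.arctan (x / d) / x = Ti2 (a / d) := by
  have h := intervalIntegral.integral_comp_div (a := 0) (b := a)
    (fun y => Real.arctan y / y) hd.ne'
  rw [zero_div, smul_eq_mul] at h
  rw [Ti2, ← mul_right_inj' hd.ne', ← h, ← intervalIntegral.integral_const_mul]
  congr 1 with x
  field_simp

theorem integral_eulerArg_div {a : ℝ} (ha : 0 < a) (ha' : a ≤ π / 2) (N : ℕ) :
    ∫ x in (0:ℝ)..a, eulerArg a x N / x = G - ∑ k ∈ range N,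
      (Ti2 (a / (π * (k + 1) - a)) - Ti2 (a / (π * (k + 1) + a))) := by
  have hp (k : ℕ) : 0 < π * ((k : ℝ) + 1) + a := by have := Real.pi_pos; positivity
  have hm (k : ℕ) := pi_mul_succ_sub_pos ha' k
  have im (k : ℕ) := intervalIntegrable_arctan_div_div ha.le (hm k)
  have ip (k : ℕ) := intervalIntegrable_arctan_div_div ha.le (hp k)
  have hG : G = Ti2 (a / a) := by rw [div_self ha.ne']; rfl
  simp only [eulerArg, sub_div, sum_div]
  rw [intervalIntegral.integral_sub (intervalIntegrable_arctan_div_div ha.le ha)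
      (by simpa only [sum_fn] using IntervalIntegrable.sum (range N) fun k _ => (im k).sub (ip k)),
    intervalIntegral.integral_finsetSum fun k _ => (im k).sub (ip k),
    integral_arctan_div_div ha, hG]
  congr 1
  refine sum_congr rfl fun k _ => ?_
  rw [intervalIntegral.integral_sub (im k) (ip k), integral_arctan_div_div (hm k),
    integral_arctan_div_div (hp k)]

theorem tendsto_integral_eulerArg_div {a : ℝ} (ha : 0 < a) (ha' : a ≤ π / 2) :
    Tendsto (fun N => ∫ x in (0:ℝ)..a, eulerArg a x N / x) atTop
      (𝓝 (∫ x in (0:ℝ)..a, Real.arctan (Real.cot a * Real.tanh x) / x)) := by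
  refine intervalIntegral.tendsto_integral_filter_of_dominated_convergence (fun _ => 1 / a)
    (Eventually.of_forall fun N => ?_) (Eventually.of_forall fun N => ae_of_all _ fun x hx => ?_)
    intervalIntegrable_const (ae_of_all _ fun x hx => ?_)
  · unfold eulerArg
    exact Measurable.aestronglyMeasurable (by fun_prop)
  · rw [Set.uIoc_of_le ha.le] at hx
    rw [Real.norm_of_nonneg (div_nonneg (eulerArg_nonneg ha ha' hx.1.le N) hx.1.le)]
    exact (div_le_div_of_nonneg_right (eulerArg_le ha ha' hx.1.le N) hx.1.le).trans
      (arctan_div_div_le hx.1.le ha)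
  · rw [Set.uIoc_of_le ha.le] at hx
    exact (tendsto_eulerArg ha ha' hx.1.le).div_const x

theorem Ti2_div_sub_Ti2_div_nonneg {a : ℝ} (ha : 0 < a) (ha' : a ≤ π / 2) (k : ℕ) :
    0 ≤ Ti2 (a / (π * (k + 1) - a)) - Ti2 (a / (π * (k + 1) + a)) := by
  have hm := pi_mul_succ_sub_pos ha' k
  have hp : 0 < π * ((k : ℝ) + 1) + a := by linarith
  rw [← integral_arctan_div_div hm, ← integral_arctan_div_div hp, sub_nonneg]
  refine intervalIntegral.integral_mono_on ha.le (intervalIntegrable_arctan_div_div ha.le hp)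
    (intervalIntegrable_arctan_div_div ha.le hm) fun x hx => ?_
  exact div_le_div_of_nonneg_right
    (sub_nonneg.1 (arctan_sub_arctan_nonneg ha ha' hx.1 k)) hx.1

theorem stmt_14 (n : ℕ) (hn : 2 ≤ n) :
    HasSum
      (fun k : ℕ =>
        Ti2 (1 / ((n : ℝ) * ((k : ℝ) + 1) - 1)) - Ti2 (1 / ((n : ℝ) * ((k : ℝ) + 1) + 1)))
      (G - ∫ x in (0:ℝ)..(π / n),
        Real.arctan (Real.cot (π / n) * Real.tanh x) / x) := by
  have hn' : (2 : ℝ) ≤ n := by exact_mod_cast hn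
  have hn0 : (0 : ℝ) < n := by linarith
  have ha : 0 < π / n := div_pos Real.pi_pos hn0
  have ha' : π / n ≤ π / 2 := div_le_div_of_nonneg_left Real.pi_pos.le two_pos hn'
  have hterm (k : ℕ) :
      Ti2 (1 / ((n : ℝ) * ((k : ℝ) + 1) - 1)) - Ti2 (1 / ((n : ℝ) * ((k : ℝ) + 1) + 1)) =
      Ti2 (π / n / (π * (k + 1) - π / n)) - Ti2 (π / n / (π * (k + 1) + π / n)) := by
    have e1 : π * ((k : ℝ) + 1) - π / n = π / n * (n * (k + 1) - 1) := by field_simp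
    have e2 : π * ((k : ℝ) + 1) + π / n = π / n * (n * (k + 1) + 1) := by field_simp
    rw [e1, e2, ← div_div, ← div_div, div_self ha.ne']
  simp only [hterm]
  rw [hasSum_iff_tendsto_nat_of_nonneg (Ti2_div_sub_Ti2_div_nonneg ha ha')]
  refine (tendsto_const_nhds.sub (tendsto_integral_eulerArg_div ha ha')).congr fun N => ?_
  rw [integral_eulerArg_div ha ha', sub_sub_cancel]
end
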